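/- arXiv:1605.07982 — 2 statements merged into one kernel-verified Lean document; each statement's English description precedes it below -/
import Mathlib

section
/- Let G be a digraph on vertex set V = A ∪ B (A, B disjoint, B nonempty) with no self-loops and weights a_{ij} > 0, such that the induced subgraph on B is strongly connected and at least one vertex of B has a neighbor in A. For i ∈ B put A_i = Σ_{j∈N_i} a_{ij}, and for X = (X_i)_{i∈B} ∈ (ℝ²)^B define f̂_i(X) = A_i X_i, ĝ_i(X) = ‖f̂_i(X)‖ f̂_i(X), and a_i(X) = (1/A_i)[ Σ_{j∈N_i∩B} a_{ij} (ĝ_j(X) − ĝ_i(X)) − Σ_{j∈N_i∩A} a_{ij} ĝ_i(X) ]. Then there exist gains γ_i > 0 (i ∈ B) and a continuous function 𝐫 : (ℝ²)^B → ℝ which is homogeneous of degree three (𝐫(λX) = λ³ 𝐫(X) for all λ > 0) and negative definite (𝐫(X) ≤ 0 for all X, with 𝐫(X) = 0 if and only if X = 0), such that Σ_{i∈B} 2 γ_i X_i · a_i(X) ≤ 𝐫(X) for all X ∈ (ℝ²)^B. -/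
open scoped BigOperators

/-- Euclidean norm on ℝ². -/
noncomputable def enorm2 (v : Fin 2 → ℝ) : ℝ :=
  Real.sqrt (v 0 ^ 2 + v 1 ^ 2)

/-- Euclidean inner product on ℝ². -/
def dot2 (v w : Fin 2 → ℝ) : ℝ := v 0 * w 0 + v 1 * w 1

/-- `A_i = Σ_{j ∈ N_i} a_{ij}`. -/
noncomputable def degW {n : ℕ} (Adj : Fin n → Fin n → Bool) (a : Fin n → Fin n → ℝ)
    (i : Fin n) : ℝ :=
  ∑ j, if Adj i j = true then a i j else 0

/-- `f̂_i(X) = A_i X_i`. -/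
noncomputable def fhat {n : ℕ} (Adj : Fin n → Fin n → Bool) (a : Fin n → Fin n → ℝ)
    (X : Fin n → Fin 2 → ℝ) (i : Fin n) : Fin 2 → ℝ :=
  degW Adj a i • X i

/-- `ĝ_i(X) = ‖f̂_i(X)‖ f̂_i(X)`. -/
noncomputable def ghat {n : ℕ} (Adj : Fin n → Fin n → Bool) (a : Fin n → Fin n → ℝ)
    (X : Fin n → Fin 2 → ℝ) (i : Fin n) : Fin 2 → ℝ :=
  enorm2 (fhat Adj a X i) • fhat Adj a X i

/-- `a_i(X) = (1/A_i) [ Σ_{j∈N_i∩B} a_{ij}(ĝ_j - ĝ_i) - Σ_{j∈N_i∖B} a_{ij} ĝ_i ]`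
(the complement of `B` plays the role of `A`). -/
noncomputable def aDyn {n : ℕ} (Adj : Fin n → Fin n → Bool) (a : Fin n → Fin n → ℝ)
    (B : Finset (Fin n)) (X : Fin n → Fin 2 → ℝ) (i : Fin n) : Fin 2 → ℝ :=
  (degW Adj a i)⁻¹ •
    ((∑ j, if Adj i j = true ∧ j ∈ B then
        a i j • (ghat Adj a X j - ghat Adj a X i) else 0) -
      ∑ j, if Adj i j = true ∧ j ∉ B then a i j • ghat Adj a X i else 0)

/-- Minimum principle for a weighted Laplacian with a killing term `b`: if every nonempty set closed
under the edges of `p` meets the support of `b`, supersolutions are nonnegative. -/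
theorem nonneg_of_laplacian_nonneg {ι : Type*} [Fintype ι] {p : ι → ι → ℝ} {b : ι → ℝ}
    (hp : ∀ i j, 0 ≤ p i j) (hb : ∀ i, 0 ≤ b i)
    (hreach : ∀ S : Set ι, S.Nonempty → (∀ i ∈ S, ∀ j, 0 < p i j → j ∈ S) → ∃ i ∈ S, 0 < b i)
    {v : ι → ℝ} (hv : ∀ i, 0 ≤ ∑ j, p i j * (v i - v j) + b i * v i) (i : ι) : 0 ≤ v i := by
  have : Nonempty ι := ⟨i⟩
  obtain ⟨m, hm⟩ := Finite.exists_min v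
  by_contra! hi
  have hneg : v m < 0 := (hm i).trans_lt hi
  have hterm : ∀ k, v k = v m → ∀ j, p k j * (v k - v j) ≤ 0 := fun k hk j =>
    mul_nonpos_of_nonneg_of_nonpos (hp k j) (by linarith [hm j])
  obtain ⟨k, hk, hbk⟩ := hreach {k | v k = v m} ⟨m, rfl⟩ (by
    intro k hk j hkj
    have hk : v k = v m := hk
    by_contra hj
    have hlt : v m < v j := lt_of_le_of_ne (hm j) (Ne.symm hj)
    have hsum : ∑ j, p k j * (v k - v j) < 0 :=
      Finset.sum_neg' (fun j _ => hterm k hk j)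
        ⟨j, Finset.mem_univ j, mul_neg_of_pos_of_neg hkj (by linarith)⟩
    have hkill : b k * v k ≤ 0 := mul_nonpos_of_nonneg_of_nonpos (hb k) (by linarith)
    linarith [hv k])
  have hk : v k = v m := hk
  have hsum : ∑ j, p k j * (v k - v j) ≤ 0 := Finset.sum_nonpos fun j _ => hterm k hk j
  have hkill : b k * v k < 0 := mul_neg_of_pos_of_neg hbk (by linarith)
  linarith [hv k]

/-- A weighted Laplacian with a reachable killing term has a strictly positive left weight vector
that it maps to the constant vector `1`. -/
theorem exists_pos_left_weights {ι : Type*} [Fintype ι] {p : ι → ι → ℝ} {b : ι → ℝ}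
    (hp : ∀ i j, 0 ≤ p i j) (hb : ∀ i, 0 ≤ b i)
    (hreach : ∀ S : Set ι, S.Nonempty → (∀ i ∈ S, ∀ j, 0 < p i j → j ∈ S) → ∃ i ∈ S, 0 < b i) :
    ∃ w : ι → ℝ, (∀ i, 0 < w i) ∧
      ∀ v : ι → ℝ, ∑ i, w i * (∑ j, p i j * (v i - v j) + b i * v i) = ∑ i, v i := by
  classical
  set M : Matrix ι ι ℝ := Matrix.diagonal (fun i => ∑ j, p i j + b i) - Matrix.of p with hM
  have hMv : ∀ v i, M.mulVec v i = ∑ j, p i j * (v i - v j) + b i * v i := by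
    intro v i
    rw [hM, Matrix.sub_mulVec, Pi.sub_apply, Matrix.mulVec_diagonal]
    simp only [Matrix.mulVec, dotProduct, Matrix.of_apply, mul_sub, Finset.sum_sub_distrib,
      ← Finset.sum_mul]
    ring
  have hnonneg : ∀ v : ι → ℝ, (∀ i, 0 ≤ M.mulVec v i) → ∀ i, 0 ≤ v i := fun v hv =>
    nonneg_of_laplacian_nonneg hp hb hreach fun i => hMv v i ▸ hv i
  have hle : ∀ v v' : ι → ℝ, M.mulVec v = M.mulVec v' → ∀ i, v i ≤ v' i := by
    intro v v' h i
    have := hnonneg (v' - v) (fun i => by simp [Matrix.mulVec_sub, h]) i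
    simpa using this
  have hunit : IsUnit M := Matrix.mulVec_injective_iff_isUnit.mp fun v v' h =>
    funext fun i => le_antisymm (hle v v' h i) (hle v' v h.symm i)
  have hdet : IsUnit M.det := (Matrix.isUnit_iff_isUnit_det M).mp hunit
  have hMN : M * M⁻¹ = 1 := Matrix.mul_nonsing_inv M hdet
  have hNM : M⁻¹ * M = 1 := Matrix.nonsing_inv_mul M hdet
  have hN : ∀ k j, 0 ≤ M⁻¹ k j := by
    intro k j
    refine hnonneg (fun k => M⁻¹ k j) (fun i => ?_) k
    change 0 ≤ (M * M⁻¹) i j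
    rw [hMN, Matrix.one_apply]
    split_ifs <;> norm_num
  refine ⟨Matrix.vecMul 1 M⁻¹, fun j => ?_, fun v => ?_⟩
  · have hw : Matrix.vecMul 1 M⁻¹ j = ∑ k, M⁻¹ k j := by simp [Matrix.vecMul, dotProduct]
    rw [hw]
    refine (Finset.sum_nonneg fun k _ => hN k j).lt_of_ne' fun h0 => ?_
    have hz := (Finset.sum_eq_zero_iff_of_nonneg fun k _ => hN k j).mp h0
    have hone : (M * M⁻¹) j j = 1 := by rw [hMN, Matrix.one_apply_eq]
    rw [Matrix.mul_apply, Finset.sum_eq_zero fun k hk => by rw [hz k hk, mul_zero]] at hone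
    exact zero_ne_one hone
  · simp only [← hMv]
    change dotProduct (Matrix.vecMul 1 M⁻¹) (M.mulVec v) = _
    rw [Matrix.dotProduct_mulVec, Matrix.vecMul_vecMul, hNM, Matrix.vecMul_one]
    simp [dotProduct]

theorem enorm2_nonneg (v : Fin 2 → ℝ) : 0 ≤ enorm2 v := Real.sqrt_nonneg _

theorem enorm2_sq (v : Fin 2 → ℝ) : enorm2 v ^ 2 = v 0 ^ 2 + v 1 ^ 2 :=
  Real.sq_sqrt (by positivity)

theorem enorm2_eq_zero_iff (v : Fin 2 → ℝ) : enorm2 v = 0 ↔ v = 0 := by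
  rw [enorm2, Real.sqrt_eq_zero (by positivity)]
  constructor
  · intro h
    obtain ⟨h0, h1⟩ := (add_eq_zero_iff_of_nonneg (sq_nonneg (v 0)) (sq_nonneg (v 1))).mp h
    ext i
    fin_cases i
    · exact pow_eq_zero_iff two_ne_zero |>.mp h0
    · exact pow_eq_zero_iff two_ne_zero |>.mp h1
  · rintro rfl
    simp

theorem enorm2_smul {c : ℝ} (hc : 0 ≤ c) (v : Fin 2 → ℝ) : enorm2 (c • v) = c * enorm2 v := by
  rw [enorm2, enorm2, ← Real.sqrt_sq hc, ← Real.sqrt_mul (sq_nonneg c), Real.sqrt_sq hc]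
  congr 1
  simp only [Pi.smul_apply, smul_eq_mul]
  ring

theorem continuous_enorm2 : Continuous enorm2 := by
  unfold enorm2
  fun_prop

theorem dot2_le (v w : Fin 2 → ℝ) : dot2 v w ≤ enorm2 v * enorm2 w := by
  refine le_of_sq_le_sq ?_ (mul_nonneg (enorm2_nonneg v) (enorm2_nonneg w))
  rw [mul_pow, enorm2_sq, enorm2_sq, dot2]
  nlinarith [sq_nonneg (v 0 * w 1 - v 1 * w 0)]

/-- Young's inequality for exponents `3` and `3/2`. -/
theorem sq_mul_sub_cube_le {s t : ℝ} (hs : 0 ≤ s) (ht : 0 ≤ t) :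
    t ^ 2 * s - s ^ 3 ≤ 2 / 3 * (t ^ 3 - s ^ 3) := by
  nlinarith [mul_nonneg (add_nonneg (add_nonneg ht ht) hs) (sq_nonneg (t - s))]

/-- Cauchy-Schwarz and Young bound for the interaction of `v` with the field `‖w‖ w - ‖v‖ v`. -/
theorem dot2_norm_smul_sub_le (v w : Fin 2 → ℝ) :
    dot2 v (enorm2 w • w - enorm2 v • v) ≤ 2 / 3 * (enorm2 w ^ 3 - enorm2 v ^ 3) := by
  have hexp : dot2 v (enorm2 w • w - enorm2 v • v)
      = enorm2 w * dot2 v w - enorm2 v * (v 0 ^ 2 + v 1 ^ 2) := by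
    simp only [dot2, Pi.sub_apply, Pi.smul_apply, smul_eq_mul]
    ring
  have hcs := mul_le_mul_of_nonneg_left (dot2_le v w) (enorm2_nonneg w)
  have hyoung := sq_mul_sub_cube_le (enorm2_nonneg v) (enorm2_nonneg w)
  rw [hexp, ← enorm2_sq]
  nlinarith

theorem dot2_norm_smul_self (v : Fin 2 → ℝ) : dot2 v (enorm2 v • v) = enorm2 v ^ 3 := by
  rw [pow_succ, enorm2_sq]
  simp only [dot2, Pi.smul_apply, smul_eq_mul]
  ring

theorem dot2_sub (v w w' : Fin 2 → ℝ) : dot2 v (w - w') = dot2 v w - dot2 v w' := by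
  simp only [dot2, Pi.sub_apply]
  ring

theorem dot2_smul (c : ℝ) (v w : Fin 2 → ℝ) : dot2 v (c • w) = c * dot2 v w := by
  simp only [dot2, Pi.smul_apply, smul_eq_mul]
  ring

theorem smul_dot2 (c : ℝ) (v w : Fin 2 → ℝ) : dot2 (c • v) w = c * dot2 v w := by
  simp only [dot2, Pi.smul_apply, smul_eq_mul]
  ring

theorem dot2_sum {ι : Type*} (s : Finset ι) (v : Fin 2 → ℝ) (w : ι → Fin 2 → ℝ) :
    dot2 v (∑ j ∈ s, w j) = ∑ j ∈ s, dot2 v (w j) := by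
  simp only [dot2, Finset.sum_apply, Finset.mul_sum, Finset.sum_add_distrib]

/-- The dissipation estimate at a single vertex. -/
theorem sq_degW_mul_dot2_aDyn_le {n : ℕ} {Adj : Fin n → Fin n → Bool} {a : Fin n → Fin n → ℝ}
    (ha : ∀ i j, Adj i j = true → 0 < a i j) (B : Finset (Fin n)) (X : Fin n → Fin 2 → ℝ)
    {i : Fin n} (hi : degW Adj a i ≠ 0) :
    degW Adj a i ^ 2 * dot2 (X i) (aDyn Adj a B X i) ≤
      -(∑ j ∈ B, (if Adj i j = true then 2 / 3 * a i j else 0) *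
            (enorm2 (fhat Adj a X i) ^ 3 - enorm2 (fhat Adj a X j) ^ 3) +
          (∑ j, if Adj i j = true ∧ j ∉ B then a i j else 0) * enorm2 (fhat Adj a X i) ^ 3) := by
  have hscale : degW Adj a i ^ 2 * dot2 (X i) (aDyn Adj a B X i) = dot2 (fhat Adj a X i)
      ((∑ j, if Adj i j = true ∧ j ∈ B then
        a i j • (ghat Adj a X j - ghat Adj a X i) else 0) -
      ∑ j, if Adj i j = true ∧ j ∉ B then a i j • ghat Adj a X i else 0) := by
    rw [aDyn, fhat, dot2_smul, smul_dot2]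
    field_simp
  have hinner : (∑ j, if Adj i j = true ∧ j ∈ B then
      a i j • (ghat Adj a X j - ghat Adj a X i) else 0) =
      ∑ j ∈ B, if Adj i j = true then a i j • (ghat Adj a X j - ghat Adj a X i) else 0 := by
    rw [← Finset.sum_filter, ← Finset.sum_filter]
    congr 1
    ext j
    simp [and_comm]
  rw [hscale, hinner, dot2_sub, dot2_sum, dot2_sum, neg_add, ← sub_eq_add_neg,
    ← Finset.sum_neg_distrib, Finset.sum_mul]
  refine sub_le_sub (Finset.sum_le_sum fun j _ => ?_) (Finset.sum_le_sum fun j _ => ?_)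
  · split_ifs with h
    · rw [dot2_smul]
      have := mul_le_mul_of_nonneg_left
        (dot2_norm_smul_sub_le (fhat Adj a X i) (fhat Adj a X j)) (ha i j h).le
      simp only [ghat]
      linarith
    · simp [dot2]
  · split_ifs
    · rw [dot2_smul, ghat, dot2_norm_smul_self]
    · simp [dot2]

/-- Claim 1: if `B` is nonempty, the induced subgraph on `B` is
strongly connected, and some vertex of `B` has a neighbour outside `B`, then there
are gains `γ_i > 0` (`i ∈ B`) and a continuous negative definite function `𝐫`,
depending only on the `B`-components and homogeneous of degree three, such that
`Σ_{i∈B} 2γ_i X_i · a_i(X) ≤ 𝐫(X)` for all `X`. -/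
theorem claim_negative_definite_bound {n : ℕ}
    (Adj : Fin n → Fin n → Bool) (hloop : ∀ i, Adj i i = false)
    (a : Fin n → Fin n → ℝ) (ha : ∀ i j, Adj i j = true → 0 < a i j)
    (B : Finset (Fin n)) (hBne : B.Nonempty)
    (hBsc : ∀ i ∈ B, ∀ j ∈ B,
      Relation.ReflTransGen (fun p q => p ∈ B ∧ q ∈ B ∧ Adj p q = true) i j)
    (hedge : ∃ i ∈ B, ∃ j, j ∉ B ∧ Adj i j = true) :
    ∃ γ : Fin n → ℝ, (∀ i ∈ B, 0 < γ i) ∧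
      ∃ rfun : (Fin n → Fin 2 → ℝ) → ℝ,
        Continuous rfun ∧
        (∀ X X' : Fin n → Fin 2 → ℝ, (∀ i ∈ B, X i = X' i) → rfun X = rfun X') ∧
        (∀ lam : ℝ, 0 < lam → ∀ X, rfun (lam • X) = lam ^ 3 * rfun X) ∧
        (∀ X, rfun X ≤ 0) ∧
        (∀ X, rfun X = 0 ↔ ∀ i ∈ B, X i = 0) ∧
        ∀ X : Fin n → Fin 2 → ℝ,
          ∑ i ∈ B, 2 * γ i * dot2 (X i) (aDyn Adj a B X i) ≤ rfun X := by
  have hdeg : ∀ i ∈ B, 0 < degW Adj a i := by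
    intro i hi
    obtain ⟨k, hk, l, hl, hkl⟩ := hedge
    have hnbr : ∃ j, Adj i j = true := by
      rcases Relation.ReflTransGen.cases_head (hBsc i hi k hk) with rfl | ⟨j, hij, _⟩
      · exact ⟨l, hkl⟩
      · exact ⟨j, hij.2.2⟩
    obtain ⟨j, hj⟩ := hnbr
    refine Finset.sum_pos' (fun j _ => ?_) ⟨j, Finset.mem_univ j, by simpa [hj] using ha i j hj⟩
    split_ifs with h
    exacts [(ha i j h).le, le_rfl]
  have hout : ∀ i j, 0 ≤ if Adj i j = true ∧ j ∉ B then a i j else 0 := by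
    intro i j
    split_ifs with h
    exacts [(ha i j h.1).le, le_rfl]
  obtain ⟨w, hwpos, hw⟩ := exists_pos_left_weights (ι := B)
    (p := fun i j => if Adj i j = true then 2 / 3 * a i j else 0)
    (b := fun i => ∑ j, if Adj i j = true ∧ j ∉ B then a i j else 0)
    (by
      intro i j
      split_ifs with h
      · linarith [ha i j h]
      · exact le_rfl)
    (fun i => Finset.sum_nonneg fun j _ => hout i j)
    (by
      rintro S ⟨i, hi⟩ hS
      obtain ⟨k, hk, l, hl, hkl⟩ := hedge
      have hmem : ∃ h : k ∈ B, (⟨k, h⟩ : B) ∈ S := by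
        refine Relation.ReflTransGen.head_induction_on
          (motive := fun x _ => (∃ h : x ∈ B, (⟨x, h⟩ : B) ∈ S) → ∃ h : k ∈ B, (⟨k, h⟩ : B) ∈ S)
          (hBsc i i.2 k hk) id ?_ ⟨i.2, hi⟩
        rintro x y ⟨hx, hy, hxy⟩ _ ih ⟨_, hxS⟩
        exact ih ⟨hy, hS _ hxS ⟨y, hy⟩ (by simpa [hxy] using ha x y hxy)⟩
      obtain ⟨h, hkS⟩ := hmem
      exact ⟨⟨k, h⟩, hkS, Finset.sum_pos' (fun j _ => hout k j)
        ⟨l, Finset.mem_univ l, by simpa [hkl, hl] using ha k l hkl⟩⟩)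
  refine ⟨fun i => if h : i ∈ B then degW Adj a i ^ 2 * w ⟨i, h⟩ else 0, fun i hi => ?_,
    fun X => -(2 * ∑ i ∈ B, enorm2 (fhat Adj a X i) ^ 3), ?_, ?_, ?_, ?_, ?_, ?_⟩
  · have := hdeg i hi
    have := hwpos ⟨i, hi⟩
    simp only [hi, dite_true]
    positivity
  · have : ∀ i, Continuous fun X : Fin n → Fin 2 → ℝ => enorm2 (fhat Adj a X i) := fun i =>
      continuous_enorm2.comp (by unfold fhat; fun_prop)
    fun_prop
  · intro X X' h
    dsimp only
    rw [Finset.sum_congr rfl fun i hi => by rw [fhat, h i hi, ← fhat]]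
  · intro lam hlam X
    have hf : ∀ i, enorm2 (fhat Adj a (lam • X) i) = lam * enorm2 (fhat Adj a X i) := by
      intro i
      rw [← enorm2_smul hlam.le, fhat, fhat, Pi.smul_apply, smul_comm]
    simp only [hf, mul_pow, ← Finset.mul_sum]
    ring
  · intro X
    have : 0 ≤ ∑ i ∈ B, enorm2 (fhat Adj a X i) ^ 3 :=
      Finset.sum_nonneg fun i _ => pow_nonneg (enorm2_nonneg _) 3
    linarith
  · intro X
    rw [neg_eq_zero, mul_eq_zero, or_iff_right two_ne_zero,
      Finset.sum_eq_zero_iff_of_nonneg fun i _ => pow_nonneg (enorm2_nonneg _) 3]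
    refine forall₂_congr fun i hi => ?_
    rw [pow_eq_zero_iff three_ne_zero, enorm2_eq_zero_iff, fhat, smul_eq_zero,
      or_iff_right (hdeg i hi).ne']
  · intro X
    have hsum := hw fun i => enorm2 (fhat Adj a X i) ^ 3
    rw [Finset.sum_coe_sort B fun i => enorm2 (fhat Adj a X i) ^ 3] at hsum
    beta_reduce
    rw [← hsum, ← Finset.sum_coe_sort B, Finset.mul_sum, ← Finset.sum_neg_distrib]
    refine Finset.sum_le_sum fun i _ => ?_
    have hbound := mul_le_mul_of_nonneg_left
      (sq_degW_mul_dot2_aDyn_le ha B X (hdeg i i.2).ne') (hwpos i).le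
    rw [← Finset.sum_coe_sort B] at hbound
    simp only [i.2, dite_true, Subtype.coe_eta]
    linarith
end

section
/- Let G be a digraph on n vertices with no self-loops containing a reverse directed spanning tree, with weights a_{ij} > 0 and weighted Laplacian L. Then the Kronecker product L ⊗ I₂ (a 2n×2n real matrix) has rank 2(n−1), and its kernel is the two-dimensional span of the vectors 𝟙 ⊗ e1 and 𝟙 ⊗ e2, where 𝟙 ∈ ℝⁿ is the all-ones vector and e1 = (1,0), e2 = (0,1) ∈ ℝ². -/
open scoped BigOperators Kronecker

/-- The weighted Laplacian `L = D - A` of a digraph with edge relation `Adj` and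
weights `a`. -/
noncomputable def lap {n : ℕ} (Adj : Fin n → Fin n → Bool) (a : Fin n → Fin n → ℝ) :
    Matrix (Fin n) (Fin n) ℝ :=
  Matrix.diagonal (fun i => ∑ j, if Adj i j = true then a i j else 0) -
    Matrix.of fun i j => if Adj i j = true then a i j else 0

/-- The Laplacian acts by weighted differences along the outgoing edges. -/
theorem lap_mulVec_apply {n : ℕ} (Adj : Fin n → Fin n → Bool) (a : Fin n → Fin n → ℝ)
    (x : Fin n → ℝ) (i : Fin n) :
    (lap Adj a).mulVec x i = ∑ j, if Adj i j = true then a i j * (x i - x j) else 0 := by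
  rw [lap, Matrix.sub_mulVec, Pi.sub_apply, Matrix.mulVec_diagonal]
  simp only [Matrix.mulVec, dotProduct, Matrix.of_apply, Finset.sum_mul]
  rw [← Finset.sum_sub_distrib]
  refine Finset.sum_congr rfl fun j _ => ?_
  split_ifs <;> ring

/-- Maximum principle: a harmonic vector attains its maximum at the root. -/
theorem le_root_of_lap_mulVec_eq_zero {n : ℕ} {Adj : Fin n → Fin n → Bool}
    {a : Fin n → Fin n → ℝ} (ha : ∀ i j, Adj i j = true → 0 < a i j) {r : Fin n}
    (hr : ∀ i, Relation.ReflTransGen (fun p q => Adj p q = true) i r)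
    {x : Fin n → ℝ} (hx : (lap Adj a).mulVec x = 0) (i : Fin n) : x i ≤ x r := by
  have : Nonempty (Fin n) := ⟨r⟩
  obtain ⟨m, hm⟩ := Finite.exists_max x
  have step : ∀ p q, x p = x m → Adj p q = true → x q = x m := by
    intro p q hp hpq
    have hsum := congrFun hx p
    rw [lap_mulVec_apply, Pi.zero_apply, Finset.sum_eq_zero_iff_of_nonneg] at hsum
    · have hq := hsum q (Finset.mem_univ q)
      rw [if_pos hpq] at hq
      rcases mul_eq_zero.1 hq with h | h
      · exact absurd h (ha p q hpq).ne'
      · linarith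
    · intro j _
      split_ifs with hj
      · exact mul_nonneg (ha p j hj).le (by linarith [hm j])
      · exact le_rfl
  have hroot : x r = x m := by
    have hpath := hr m
    clear hr
    induction hpath with
    | refl => rfl
    | tail _ hpq ih => exact step _ _ ih hpq
  exact hroot ▸ hm i

/-- If every vertex reaches `r`, the kernel of the Laplacian consists of the constant vectors. -/
theorem lap_mulVec_eq_zero_iff {n : ℕ} {Adj : Fin n → Fin n → Bool}
    {a : Fin n → Fin n → ℝ} (ha : ∀ i j, Adj i j = true → 0 < a i j) {r : Fin n}
    (hr : ∀ i, Relation.ReflTransGen (fun p q => Adj p q = true) i r) (x : Fin n → ℝ) :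
    (lap Adj a).mulVec x = 0 ↔ ∀ i, x i = x r := by
  refine ⟨fun hx i => le_antisymm (le_root_of_lap_mulVec_eq_zero ha hr hx i) ?_, fun hx => ?_⟩
  · have hneg : (lap Adj a).mulVec (-x) = 0 := by rw [Matrix.mulVec_neg, hx, neg_zero]
    exact neg_le_neg_iff.1 (le_root_of_lap_mulVec_eq_zero ha hr hneg i)
  · ext i
    simp [lap_mulVec_apply, hx]

/-- `M ⊗ 1` acts as `M` on each slice of a vector. -/
theorem kronecker_one_mulVec_apply {m k : Type*} [Fintype m] [Fintype k] [DecidableEq k]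
    (M : Matrix m m ℝ) (v : m × k → ℝ) (p : m × k) :
    (M ⊗ₖ (1 : Matrix k k ℝ)).mulVec v p = M.mulVec (fun i => v (i, p.2)) p.1 := by
  simp [Matrix.mulVec, dotProduct, Fintype.sum_prod_type, Matrix.kroneckerMap_apply,
    Matrix.one_apply]

/-- if the digraph (no self-loops, positive weights) contains a reverse
directed spanning tree, then `L ⊗ I₂` has rank `2(n-1)` and its kernel is the span
of `𝟙 ⊗ e1` and `𝟙 ⊗ e2`. -/
theorem laplacian_kronecker_rank_and_kernel {n : ℕ}
    (Adj : Fin n → Fin n → Bool) (hloop : ∀ i, Adj i i = false)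
    (a : Fin n → Fin n → ℝ) (ha : ∀ i j, Adj i j = true → 0 < a i j)
    (htree : ∃ r : Fin n, ∀ i, Relation.ReflTransGen (fun p q => Adj p q = true) i r) :
    (lap Adj a ⊗ₖ (1 : Matrix (Fin 2) (Fin 2) ℝ)).rank = 2 * (n - 1) ∧
    LinearMap.ker (Matrix.mulVecLin (lap Adj a ⊗ₖ (1 : Matrix (Fin 2) (Fin 2) ℝ))) =
      Submodule.span ℝ
        {(fun p => if p.2 = 0 then 1 else 0 : Fin n × Fin 2 → ℝ),
         (fun p => if p.2 = 1 then 1 else 0 : Fin n × Fin 2 → ℝ)} := by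
  obtain ⟨r, hr⟩ := htree
  have hker : LinearMap.ker
      (Matrix.mulVecLin (lap Adj a ⊗ₖ (1 : Matrix (Fin 2) (Fin 2) ℝ))) =
      Submodule.span ℝ
        {(fun p => if p.2 = 0 then 1 else 0 : Fin n × Fin 2 → ℝ),
         (fun p => if p.2 = 1 then 1 else 0 : Fin n × Fin 2 → ℝ)} := by
    ext v
    have hslices : (lap Adj a ⊗ₖ (1 : Matrix (Fin 2) (Fin 2) ℝ)).mulVec v = 0 ↔
        ∀ c i, v (i, c) = v (r, c) := by
      simp only [← lap_mulVec_eq_zero_iff ha hr (fun i => v (i, _)), funext_iff,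
        kronecker_one_mulVec_apply, Prod.forall, Pi.zero_apply]
      exact forall_comm
    rw [LinearMap.mem_ker, Matrix.mulVecLin_apply, hslices, Submodule.mem_span_pair]
    constructor
    · intro h
      refine ⟨v (r, 0), v (r, 1), ?_⟩
      ext ⟨i, c⟩
      fin_cases c <;> simp [h _ i]
    · rintro ⟨s, t, rfl⟩ c i
      rfl
  refine ⟨?_, hker⟩
  have hindep : LinearIndependent ℝ
      ![(fun p => if p.2 = 0 then 1 else 0 : Fin n × Fin 2 → ℝ),
        (fun p => if p.2 = 1 then 1 else 0 : Fin n × Fin 2 → ℝ)] := by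
    refine LinearIndependent.pair_iff.2 fun s t h => ⟨?_, ?_⟩
    · simpa using congrFun h (r, 0)
    · simpa using congrFun h (r, 1)
  have hdim := finrank_span_eq_card hindep
  rw [Matrix.range_cons_cons_empty, ← hker, Fintype.card_fin] at hdim
  have hrank := LinearMap.finrank_range_add_finrank_ker
    (Matrix.mulVecLin (lap Adj a ⊗ₖ (1 : Matrix (Fin 2) (Fin 2) ℝ)))
  rw [hdim, Module.finrank_fintype_fun_eq_card, Fintype.card_prod, Fintype.card_fin,
    Fintype.card_fin] at hrank
  rw [Matrix.rank]
  omega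
end
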